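/- For all s: N'(s) = −k_n(s)·T(s) − τ_g(s)·B(s), ‖N'(s)‖² = k_n(s)² + τ_g(s)², and ‖N'(s) × N''(s)‖² = (k_n(s)² + τ_g(s)²)³ + (k_g(s)·(k_n(s)² + τ_g(s)²) + k_n(s)·τ_g'(s) − k_n'(s)·τ_g(s))². In particular, at any s with k_n(s)² + τ_g(s)² > 0, the curvature ‖N'(s) × N''(s)‖/‖N'(s)‖³ of the spherical image N ∘ α equals √(1 + μ(s)²), where μ(s) = (k_g(s)·(k_n(s)² + τ_g(s)²) + k_n(s)·τ_g'(s) − k_n'(s)·τ_g(s))/(k_n(s)² + τ_g(s)²)^{3/2}. -/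

import Mathlib

open scoped RealInnerProductSpace

noncomputable section

/-- The cross product on `EuclideanSpace ℝ (Fin 3)`. -/
def cross3 (u v : EuclideanSpace ℝ (Fin 3)) : EuclideanSpace ℝ (Fin 3) :=
  (EuclideanSpace.equiv (Fin 3) ℝ).symm
    (crossProduct ((EuclideanSpace.equiv (Fin 3) ℝ) u) ((EuclideanSpace.equiv (Fin 3) ℝ) v))

section CrossProduct

variable (u v : EuclideanSpace ℝ (Fin 3))

lemma inner_left_cross3 : ⟪u, cross3 u v⟫ = 0 := by
  simp [cross3, PiLp.inner_apply, Fin.sum_univ_three, cross_apply]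
  ring

lemma inner_right_cross3 : ⟪v, cross3 u v⟫ = 0 := by
  simp [cross3, PiLp.inner_apply, Fin.sum_univ_three, cross_apply]
  ring

lemma norm_cross3_sq : ‖cross3 u v‖ ^ 2 = ‖u‖ ^ 2 * ‖v‖ ^ 2 - ⟪u, v⟫ ^ 2 := by
  simp [cross3, PiLp.inner_apply, EuclideanSpace.real_norm_sq_eq, Fin.sum_univ_three, cross_apply]
  ring

lemma ContDiff.cross3 {n : WithTop ℕ∞} {f g : ℝ → EuclideanSpace ℝ (Fin 3)}
    (hf : ContDiff ℝ n f) (hg : ContDiff ℝ n g) : ContDiff ℝ n fun s => cross3 (f s) (g s) := by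
  rw [contDiff_euclidean] at hf hg ⊢
  have := hf 0; have := hf 1; have := hf 2
  have := hg 0; have := hg 1; have := hg 2
  intro i
  fin_cases i <;> simp [_root_.cross3, cross_apply] <;> fun_prop

end CrossProduct

section Frame

variable {E : Type*} [NormedAddCommGroup E] [InnerProductSpace ℝ E]

lemma inner_deriv_left_of_inner_eq_const {f g : ℝ → E} {c : ℝ} (hf : Differentiable ℝ f)
    (hg : Differentiable ℝ g) (h : ∀ s, ⟪f s, g s⟫ = c) (s : ℝ) :
    ⟪deriv f s, g s⟫ = -⟪deriv g s, f s⟫ := by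
  have h₁ := (hf s).hasDerivAt.inner ℝ (hg s).hasDerivAt
  have h₂ : (fun t => ⟪f t, g t⟫) = fun _ => c := funext h
  rw [h₂] at h₁
  have h₃ := h₁.unique (hasDerivAt_const s c)
  rw [real_inner_comm (f s)]
  linarith

lemma eq_sum_inner_smul_of_orthonormal {e₁ e₂ e₃ : EuclideanSpace ℝ (Fin 3)}
    (h : Orthonormal ℝ ![e₁, e₂, e₃]) (v : EuclideanSpace ℝ (Fin 3)) :
    v = ⟪v, e₁⟫ • e₁ + ⟪v, e₂⟫ • e₂ + ⟪v, e₃⟫ • e₃ := by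
  let b := basisOfOrthonormalOfCardEqFinrank h (by simp)
  have hb : ⇑b = ![e₁, e₂, e₃] := coe_basisOfOrthonormalOfCardEqFinrank h (by simp)
  have hv := ((b.toOrthonormalBasis (by rwa [hb])).sum_repr' v).symm
  simpa [hb, Fin.sum_univ_three, real_inner_comm] using hv

lemma inner_linear_combination {e₁ e₂ e₃ : E} (h : Orthonormal ℝ ![e₁, e₂, e₃])
    (a b c x y z : ℝ) :
    ⟪a • e₁ + b • e₂ + c • e₃, x • e₁ + y • e₂ + z • e₃⟫ = a * x + b * y + c * z := by
  simpa [Fin.sum_univ_three] using h.inner_sum ![a, b, c] ![x, y, z] Finset.univ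

end Frame

theorem stmt3
    (α N : ℝ → EuclideanSpace ℝ (Fin 3))
    (hα : ContDiff ℝ (⊤ : ℕ∞) α) (hN : ContDiff ℝ (⊤ : ℕ∞) N)
    (hunit : ∀ s, ‖deriv α s‖ = 1)
    (hNunit : ∀ s, ‖N s‖ = 1)
    (hNT : ∀ s, ⟪N s, deriv α s⟫ = 0)
    (T B : ℝ → EuclideanSpace ℝ (Fin 3))
    (hT : ∀ s, T s = deriv α s)
    (hB : ∀ s, B s = cross3 (N s) (T s))
    (kn kg τg : ℝ → ℝ)
    (hkn : ∀ s, kn s = ⟪deriv T s, N s⟫)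
    (hkg : ∀ s, kg s = ⟪deriv T s, B s⟫)
    (hτg : ∀ s, τg s = ⟪deriv B s, N s⟫)
    (μ : ℝ → ℝ)
    (hμ : ∀ s, μ s = (kg s * (kn s ^ 2 + τg s ^ 2) + kn s * deriv τg s - deriv kn s * τg s) /
      Real.sqrt ((kn s ^ 2 + τg s ^ 2) ^ 3))
    :
    ∀ s, deriv N s = -(kn s • T s) - τg s • B s ∧
      ‖deriv N s‖ ^ 2 = kn s ^ 2 + τg s ^ 2 ∧
      ‖cross3 (deriv N s) (deriv (deriv N) s)‖ ^ 2 =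
        (kn s ^ 2 + τg s ^ 2) ^ 3 +
          (kg s * (kn s ^ 2 + τg s ^ 2) + kn s * deriv τg s - deriv kn s * τg s) ^ 2 ∧
      (0 < kn s ^ 2 + τg s ^ 2 →
        ‖cross3 (deriv N s) (deriv (deriv N) s)‖ / ‖deriv N s‖ ^ 3 =
          Real.sqrt (1 + μ s ^ 2)) := by
  obtain rfl : T = deriv α := funext hT
  have hTs : ContDiff ℝ (⊤ : ℕ∞) (deriv α) := (contDiff_infty_iff_deriv.1 hα).2
  have hNs : ContDiff ℝ (⊤ : ℕ∞) (deriv N) := (contDiff_infty_iff_deriv.1 hN).2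
  have hBs : ContDiff ℝ (⊤ : ℕ∞) B := by
    rw [show B = fun s => cross3 (N s) (deriv α s) from funext hB]
    exact hN.cross3 hTs
  have hT's : ContDiff ℝ (⊤ : ℕ∞) (deriv (deriv α)) := (contDiff_infty_iff_deriv.1 hTs).2
  have hB's : ContDiff ℝ (⊤ : ℕ∞) (deriv B) := (contDiff_infty_iff_deriv.1 hBs).2
  have hknd : Differentiable ℝ kn := by
    rw [show kn = _ from funext hkn]
    exact (hT's.inner ℝ hN).differentiable (by simp)
  have hτgd : Differentiable ℝ τg := by
    rw [show τg = _ from funext hτg]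
    exact (hB's.inner ℝ hN).differentiable (by simp)
  have hTd : Differentiable ℝ (deriv α) := hTs.differentiable (by simp)
  have hNd : Differentiable ℝ N := hN.differentiable (by simp)
  have hBd : Differentiable ℝ B := hBs.differentiable (by simp)
  have hTT (s) : ⟪deriv α s, deriv α s⟫ = 1 := by simp [hunit s]
  have hNN (s) : ⟪N s, N s⟫ = 1 := by simp [hNunit s]
  have hNB (s) : ⟪N s, B s⟫ = 0 := by rw [hB]; exact inner_left_cross3 _ _
  have hTB (s) : ⟪deriv α s, B s⟫ = 0 := by rw [hB]; exact inner_right_cross3 _ _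
  have hBB (s) : ⟪B s, B s⟫ = 1 := by
    rw [real_inner_self_eq_norm_sq, hB, norm_cross3_sq, hNT, hunit, hNunit]; norm_num
  have hframe (s) : Orthonormal ℝ ![deriv α s, B s, N s] := by
    rw [orthonormal_iff_ite]
    intro i j
    have hTN : ⟪deriv α s, N s⟫ = 0 := by rw [real_inner_comm, hNT]
    have hBN : ⟪B s, N s⟫ = 0 := by rw [real_inner_comm, hNB]
    have hBT : ⟪B s, deriv α s⟫ = 0 := by rw [real_inner_comm, hTB]
    have hB₁ : ‖B s‖ = 1 := by rw [norm_eq_sqrt_real_inner, hBB, Real.sqrt_one]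
    fin_cases i <;> fin_cases j <;>
      simp [hunit, hNunit, hB₁, hTB, hNB, hNT, hTN, hBN, hBT]
  have hN' (s) : deriv N s = (-kn s) • deriv α s + (-τg s) • B s + (0 : ℝ) • N s := by
    have h := eq_sum_inner_smul_of_orthonormal (hframe s) (deriv N s)
    have h₀ := inner_deriv_left_of_inner_eq_const hNd hNd hNN s
    rwa [inner_deriv_left_of_inner_eq_const hNd hTd hNT, ← hkn,
      inner_deriv_left_of_inner_eq_const hNd hBd hNB, ← hτg,
      show ⟪deriv N s, N s⟫ = 0 by linarith] at h
  have hT' (s) : deriv (deriv α) s = kg s • B s + kn s • N s := by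
    have h := eq_sum_inner_smul_of_orthonormal (hframe s) (deriv (deriv α) s)
    have h₀ := inner_deriv_left_of_inner_eq_const hTd hTd hTT s
    rwa [← hkg, ← hkn, show ⟪deriv (deriv α) s, deriv α s⟫ = 0 by linarith, zero_smul,
      zero_add] at h
  have hB' (s) : deriv B s = (-kg s) • deriv α s + τg s • N s := by
    have h := eq_sum_inner_smul_of_orthonormal (hframe s) (deriv B s)
    have h₀ := inner_deriv_left_of_inner_eq_const hBd hBd hBB s
    have h₁ := inner_deriv_left_of_inner_eq_const hTd hBd hTB s
    rwa [← hτg, show ⟪deriv B s, B s⟫ = 0 by linarith,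
      show ⟪deriv B s, deriv α s⟫ = -kg s by rw [hkg]; linarith, zero_smul, add_zero] at h
  have hN'' (s) : deriv (deriv N) s =
      (-deriv kn s + τg s * kg s) • deriv α s + (-deriv τg s - kn s * kg s) • B s +
        (-(kn s ^ 2 + τg s ^ 2)) • N s := by
    have h := ((hknd s).hasDerivAt.neg.smul (hTd s).hasDerivAt).add
      ((hτgd s).hasDerivAt.neg.smul (hBd s).hasDerivAt)
    have he : deriv N = (-kn) • deriv α + (-τg) • B := by
      funext t
      simp [hN' t]
    rw [he, h.deriv, hT', hB']
    simp only [Pi.neg_apply]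
    module
  intro s
  have hnorm : ‖deriv N s‖ ^ 2 = kn s ^ 2 + τg s ^ 2 := by
    rw [← real_inner_self_eq_norm_sq, hN', inner_linear_combination (hframe s)]
    ring
  have hcross : ‖cross3 (deriv N s) (deriv (deriv N) s)‖ ^ 2 =
      (kn s ^ 2 + τg s ^ 2) ^ 3 +
        (kg s * (kn s ^ 2 + τg s ^ 2) + kn s * deriv τg s - deriv kn s * τg s) ^ 2 := by
    rw [norm_cross3_sq, hnorm, ← real_inner_self_eq_norm_sq, hN'', hN',
      inner_linear_combination (hframe s), inner_linear_combination (hframe s)]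
    ring
  refine ⟨by rw [hN']; module, hnorm, hcross, fun hpos => ?_⟩
  symm
  rw [Real.sqrt_eq_iff_mul_self_eq (by positivity) (by positivity), ← sq, div_pow, hcross,
    ← pow_mul, mul_comm 3 2, pow_mul, hnorm, hμ, div_pow, Real.sq_sqrt (by positivity)]
  field_simp
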